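/- There is a nonzero absolute constant $c$ such that for every Schwartz function $A$ on $\mathbb{R}^2$ and every Schwartz function $f$ on $\mathbb{R}^2$ one has, for almost every $x\in\mathbb{R}^2$, the identity $[|D_2|,[|D_1|,A]]f(x)=c\cdot\mathrm{p.v.}\int_{\mathbb{R}^2} f(x+t)\,\big(\tfrac{\Delta_{t_1}^{(1)}}{t_1}\circ\tfrac{\Delta_{t_2}^{(2)}}{t_2}A(x)\big)\,\tfrac{dt_1}{t_1}\tfrac{dt_2}{t_2}$, where the commutators are $[|D_1|,A]f:=|D_1|(Af)-A\,|D_1|f$ and $[|D_2|,[|D_1|,A]]f:=|D_2|([|D_1|,A]f)-[|D_1|,A](|D_2|f)$. -/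

import Mathlib

open MeasureTheory Filter Topology SchwartzMap ENNReal

/-- Two-dimensional Fourier transform `ĝ(ξ,η) = ∫ g(y) e^{-2πi(y₁ξ + y₂η)} dy`. -/
noncomputable def ft2 (g : ℝ × ℝ → ℂ) (ξ η : ℝ) : ℂ :=
  ∫ y : ℝ × ℝ, g y * Complex.exp (((-2) * Real.pi * (y.1 * ξ + y.2 * η) : ℝ) * Complex.I)

/-- The Fourier multiplier `|D₁|` with symbol `|ξ₁|`, realized by Fourier inversion. -/
noncomputable def absD1 (g : ℝ × ℝ → ℂ) (x : ℝ × ℝ) : ℂ :=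
  ∫ ξ : ℝ × ℝ, ((|ξ.1| : ℝ) : ℂ) * ft2 g ξ.1 ξ.2 *
    Complex.exp (((2 : ℝ) * Real.pi * (x.1 * ξ.1 + x.2 * ξ.2) : ℝ) * Complex.I)

/-- The Fourier multiplier `|D₂|` with symbol `|ξ₂|`, realized by Fourier inversion. -/
noncomputable def absD2 (g : ℝ × ℝ → ℂ) (x : ℝ × ℝ) : ℂ :=
  ∫ ξ : ℝ × ℝ, ((|ξ.2| : ℝ) : ℂ) * ft2 g ξ.1 ξ.2 *
    Complex.exp (((2 : ℝ) * Real.pi * (x.1 * ξ.1 + x.2 * ξ.2) : ℝ) * Complex.I)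

/-- The commutator `[|D₁|, A] g = |D₁|(Ag) - A |D₁| g`. -/
noncomputable def comm1 (A g : ℝ × ℝ → ℂ) : ℝ × ℝ → ℂ :=
  fun x => absD1 (fun y => A y * g y) x - A x * absD1 g x

/-- The double commutator `[|D₂|, [|D₁|, A]] f = |D₂|([|D₁|,A] f) - [|D₁|,A](|D₂| f)`. -/
noncomputable def doubleComm (A f : ℝ × ℝ → ℂ) : ℝ × ℝ → ℂ :=
  fun x => absD2 (comm1 A f) x - comm1 A (fun y => absD2 f y) x

/-- The double difference quotient `Δ_{t₁}^{(1)}/t₁ ∘ Δ_{t₂}^{(2)}/t₂ A(x)`. -/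
noncomputable def diffQuot2 (A : ℝ × ℝ → ℂ) (x t : ℝ × ℝ) : ℂ :=
  (A (x.1 + t.1, x.2 + t.2) - A (x.1 + t.1, x.2) - A (x.1, x.2 + t.2) + A (x.1, x.2)) /
    ((t.1 : ℂ) * (t.2 : ℂ))

/-- The truncated region `{t ∈ ℝ² : ε < |t₁|, |t₂| < ε⁻¹}`. -/
def truncSet2 (ε : ℝ) : Set (ℝ × ℝ) :=
  {t | (ε < |t.1| ∧ |t.1| < ε⁻¹) ∧ (ε < |t.2| ∧ |t.2| < ε⁻¹)}


noncomputable def dt (x ξ : ℝ × ℝ) : ℝ := x.1 * ξ.1 + x.2 * ξ.2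

noncomputable def ee (r : ℝ) : ℂ := Complex.exp ((2 * Real.pi * r : ℝ) * Complex.I)

lemma ee_add (r s : ℝ) : ee (r + s) = ee r * ee s := by
  unfold ee; rw [← Complex.exp_add]; congr 1; push_cast; ring

lemma ee_norm (r : ℝ) : ‖ee r‖ = 1 := by
  unfold ee; exact Complex.norm_exp_ofReal_mul_I _

lemma ee_zero : ee 0 = 1 := by simp [ee]

@[fun_prop] lemma ee_cont : Continuous ee := by unfold ee; fun_prop

@[fun_prop] lemma dt_cont : Continuous (fun p : (ℝ × ℝ) × (ℝ × ℝ) => dt p.1 p.2) := by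
  unfold dt; fun_prop

@[fun_prop] lemma dt_cont' {X : Type*} [TopologicalSpace X] {u v : X → ℝ × ℝ}
    (hu : Continuous u) (hv : Continuous v) : Continuous (fun p => dt (u p) (v p)) := by
  unfold dt; fun_prop

lemma dt_add_left (x y z) : dt (x + y) z = dt x z + dt y z := by simp [dt]; ring
lemma dt_add_right (x y z) : dt x (y + z) = dt x y + dt x z := by simp [dt]; ring
lemma dt_sub_right (x y z) : dt x (y - z) = dt x y - dt x z := by simp [dt]; ring
lemma dt_smul_left (t : ℝ) (y z) : dt (t • y) z = t * dt y z := by simp [dt]; ring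
lemma dt_comm (x y) : dt x y = dt y x := by simp [dt]; ring
lemma abs_dt_le (x y : ℝ × ℝ) : |dt x y| ≤ 2 * ‖x‖ * ‖y‖ := by
  unfold dt
  have h1 := norm_fst_le x
  have h2 := norm_snd_le x
  have h3 := norm_fst_le y
  have h4 := norm_snd_le y
  rw [Real.norm_eq_abs] at h1 h2 h3 h4
  calc _ ≤ |x.1| * |y.1| + |x.2| * |y.2| := by rw [← abs_mul, ← abs_mul]; exact abs_add_le _ _
    _ ≤ ‖x‖ * ‖y‖ + ‖x‖ * ‖y‖ := by gcongr
    _ = _ := by ring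

/-- inverse transform -/
noncomputable def TT (h : ℝ × ℝ → ℂ) (x : ℝ × ℝ) : ℂ := ∫ ξ, h ξ * ee (dt x ξ)

noncomputable def FF (h : ℝ × ℝ → ℂ) (ξ : ℝ × ℝ) : ℂ := ∫ y, h y * ee (-dt y ξ)

lemma ft2_eq (g : ℝ × ℝ → ℂ) (ξ : ℝ × ℝ) : ft2 g ξ.1 ξ.2 = FF g ξ := by
  unfold ft2 FF ee dt
  congr 1; ext y; congr 4; ring

noncomputable def absD (v : ℝ × ℝ) (g : ℝ × ℝ → ℂ) (x : ℝ × ℝ) : ℂ :=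
  TT (fun ξ => ((|dt v ξ| : ℝ) : ℂ) * FF g ξ) x

lemma absD1_eq (g : ℝ × ℝ → ℂ) : absD1 g = absD (1, 0) g := by
  ext x
  unfold absD1 absD TT
  simp_rw [ft2_eq]
  congr 1; ext ξ; simp only [ee, dt]; simp

lemma absD2_eq (g : ℝ × ℝ → ℂ) : absD2 g = absD (0, 1) g := by
  ext x
  unfold absD2 absD TT
  simp_rw [ft2_eq]
  congr 1; ext ξ; simp only [ee, dt]; simp

open FourierTransform in
lemma fourier_FF (h : ℝ × ℝ → ℂ) (ξ : WithLp 2 (ℝ × ℝ)) :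
    𝓕 (fun y : WithLp 2 (ℝ × ℝ) => h y.ofLp) ξ = FF h ξ.ofLp := by
  rw [Real.fourier_eq']
  unfold FF
  rw [← (WithLp.volume_preserving_ofLp ℝ ℝ).integral_comp
    (MeasurableEquiv.toLp 2 (ℝ × ℝ)).symm.measurableEmbedding]
  congr 1; ext y
  rw [smul_eq_mul, mul_comm]
  congr 1
  simp only [ee, dt, WithLp.prod_inner_apply]
  congr 1
  simp; ring

open FourierTransform in
lemma fourier_TT (h : ℝ × ℝ → ℂ) (ξ : WithLp 2 (ℝ × ℝ)) :
    𝓕⁻ (fun y : WithLp 2 (ℝ × ℝ) => h y.ofLp) ξ = TT h ξ.ofLp := by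
  rw [Real.fourierInv_eq']
  unfold TT
  rw [← (WithLp.volume_preserving_ofLp ℝ ℝ).integral_comp
    (MeasurableEquiv.toLp 2 (ℝ × ℝ)).symm.measurableEmbedding]
  congr 1; ext y
  rw [smul_eq_mul, mul_comm]
  congr 1

lemma exists_FF (g : 𝓢(ℝ × ℝ, ℂ)) : ∃ G : 𝓢(ℝ × ℝ, ℂ), ⇑G = FF g := by
  let e := WithLp.prodContinuousLinearEquiv 2 ℝ ℝ ℝ
  let g' : 𝓢(WithLp 2 (ℝ × ℝ), ℂ) := SchwartzMap.compCLMOfContinuousLinearEquiv ℝ e g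
  let G := SchwartzMap.compCLMOfContinuousLinearEquiv ℝ e.symm (FourierTransform.fourier g')
  refine ⟨G, ?_⟩
  ext ξ
  exact fourier_FF g (WithLp.toLp 2 ξ)

lemma integrable_lp {h : ℝ × ℝ → ℂ} (hi : Integrable h) :
    Integrable (fun y : WithLp 2 (ℝ × ℝ) => h y.ofLp) :=
  (WithLp.volume_preserving_ofLp ℝ ℝ).integrable_comp_of_integrable hi

lemma TT_FF {h : ℝ × ℝ → ℂ} (hc : Continuous h) (hi : Integrable h) (hF : Integrable (FF h)) :
    TT (FF h) = h := by
  ext x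
  have := Continuous.fourierInv_fourier_eq (f := fun y : WithLp 2 (ℝ × ℝ) => h y.ofLp)
    (by fun_prop) (integrable_lp hi) (by
      have : FourierTransform.fourier (fun y : WithLp 2 (ℝ × ℝ) => h y.ofLp)
        = fun ξ => FF h ξ.ofLp := by ext ξ; exact fourier_FF h ξ
      rw [this]
      exact integrable_lp hF)
  have h2 := congrFun this (WithLp.toLp 2 x)
  rw [show FourierTransform.fourier (fun y : WithLp 2 (ℝ × ℝ) => h y.ofLp)
        = fun ξ => FF h ξ.ofLp by ext ξ; exact fourier_FF h ξ] at h2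
  rw [fourier_TT] at h2
  exact h2

lemma TT_eq_FF_neg (h : ℝ × ℝ → ℂ) (x : ℝ × ℝ) : TT h x = FF h (-x) := by
  unfold TT FF; congr 1; ext y; simp only [dt]; congr 2; simp; ring

lemma FF_TT {h : ℝ × ℝ → ℂ} (hc : Continuous h) (hi : Integrable h) (hF : Integrable (TT h)) :
    FF (TT h) = h := by
  have e1 : TT h = fun x => FF h (-x) := by ext x; exact TT_eq_FF_neg h x
  have hF' : Integrable (FF h) := by
    have := hF.comp_neg
    rw [e1] at this; simpa using this
  ext ξ
  have e2 := congrFun (TT_FF hc hi hF') ξ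
  have e3 : FF (TT h) ξ = TT (FF h) ξ := by
    rw [e1, TT, FF, ← integral_neg_eq_self]
    refine integral_congr_ae (Eventually.of_forall fun y => ?_)
    have : -dt (-y) ξ = dt ξ y := by simp only [dt, Prod.fst_neg, Prod.snd_neg]; ring
    simp only [this, neg_neg]
  exact e3.trans e2

lemma schwartz_inv (g : 𝓢(ℝ × ℝ, ℂ)) : TT (FF g) = g := by
  obtain ⟨G, hG⟩ := exists_FF g
  exact TT_FF g.continuous g.integrable (by rw [← hG]; exact G.integrable)


noncomputable def qq (b t : ℝ) : ℝ := (1 - Real.cos (2 * Real.pi * (t * b))) / t ^ 2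

lemma qq_nonneg (b t : ℝ) : 0 ≤ qq b t := by
  unfold qq
  have := Real.cos_le_one (2 * Real.pi * (t * b))
  exact div_nonneg (by linarith) (sq_nonneg t)

lemma qq_le (b t : ℝ) : qq b t ≤ (2 + (2 * Real.pi * b) ^ 2 / 2) * (1 + t ^ 2)⁻¹ := by
  unfold qq
  by_cases ht : t = 0
  · subst ht; simp; positivity
  have h1 := Real.one_sub_sq_div_two_le_cos (x := 2 * Real.pi * (t * b))
  have h2 := Real.neg_one_le_cos (2 * Real.pi * (t * b))
  have ht2 : 0 < t ^ 2 := by positivity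
  rw [← div_eq_mul_inv, div_le_div_iff₀ ht2 (by positivity)]
  nlinarith

lemma qq_meas : Measurable (fun p : ℝ × ℝ => qq p.1 p.2) := by
  unfold qq; fun_prop

lemma qq_int (b : ℝ) : Integrable (qq b) := by
  refine (integrable_inv_one_add_sq.const_mul (2 + (2 * Real.pi * b) ^ 2 / 2)).mono'
    (by unfold qq; exact Measurable.aestronglyMeasurable (by fun_prop))
    (Eventually.of_forall fun t => ?_)
  rw [Real.norm_of_nonneg (qq_nonneg b t)]
  exact qq_le b t

noncomputable def KK : ℝ := ∫ t, qq 1 t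

lemma KK_pos : 0 < KK := by
  unfold KK
  rw [integral_pos_iff_support_of_nonneg (fun t => qq_nonneg 1 t) (qq_int 1)]
  have : Set.Ioo (0:ℝ) 1 ⊆ Function.support (qq 1) := by
    intro t ht
    simp only [Function.mem_support, qq]
    have hc : Real.cos (2 * Real.pi * (t * 1)) ≠ 1 := by
      intro h
      rw [Real.cos_eq_one_iff] at h
      obtain ⟨n, hn⟩ := h
      have hp := Real.pi_pos
      have : (n : ℝ) = t := by
        have : (2 * Real.pi) * (n - t) = 0 := by linarith
        rcases mul_eq_zero.1 this with h | h
        · exfalso; linarith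
        · linarith
      have h1 : (0:ℝ) < n := this ▸ ht.1
      have h2 : (n:ℝ) < 1 := this ▸ ht.2
      norm_cast at h1 h2
      omega
    have := ht.1
    have h0 : (1 - Real.cos (2 * Real.pi * (t * 1))) ≠ 0 := fun h => hc (by linarith)
    positivity
  refine lt_of_lt_of_le ?_ (measure_mono this)
  simp

lemma qq_integral (b : ℝ) : ∫ t, qq b t = |b| * KK := by
  by_cases hb : b = 0
  · subst hb; simp [qq]
  have : ∀ t, qq b t = b ^ 2 * qq 1 (b * t) := by
    intro t
    unfold qq
    by_cases ht : t = 0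
    · subst ht; simp
    field_simp
  simp_rw [this]
  rw [integral_const_mul, Measure.integral_comp_mul_left, smul_eq_mul, ← KK]
  rw [abs_inv, ← sq_abs]
  have : |b| ≠ 0 := by positivity
  field_simp

lemma integrable_poly (G : 𝓢(ℝ × ℝ, ℂ)) : Integrable (fun ξ => (1 + ‖ξ‖) ^ 2 * ‖G ξ‖) := by
  have h0 := G.integrable_pow_mul volume 0
  have h1 := G.integrable_pow_mul volume 1
  have h2 := G.integrable_pow_mul volume 2
  refine ((h0.add (h1.const_mul 2)).add h2).congr (Eventually.of_forall fun x => ?_)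
  simp; ring

lemma decay4 (g : 𝓢(ℝ × ℝ, ℂ)) : ∃ C, 0 ≤ C ∧ ∀ x, ‖g x‖ ≤ C * ((1 + ‖x‖) ^ 4)⁻¹ := by
  have key := fun x =>
    one_add_le_sup_seminorm_apply (𝕜 := ℝ) (m := (4, 0)) (k := 4) (n := 0) le_rfl le_rfl g x
  simp only [norm_iteratedFDeriv_zero] at key
  refine ⟨2 ^ 4 * ((Finset.Iic (4, 0)).sup fun m => SchwartzMap.seminorm ℝ m.1 m.2) g, ?_, fun x => ?_⟩
  rotate_left 1
  · rw [← div_eq_mul_inv, le_div_iff₀ (by positivity), mul_comm]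
    exact key x
  · exact le_trans (by positivity) (key 0)

lemma int4 : Integrable (fun x : ℝ × ℝ => ((1 + ‖x‖) ^ 4)⁻¹) := by
  have := integrable_one_add_norm (E := ℝ × ℝ) (μ := volume) (r := 4) (by simp; norm_num)
  refine this.congr (Eventually.of_forall fun x => ?_)
  simp only
  rw [Real.rpow_neg (by positivity)]
  norm_cast

lemma second_diff {φ φ' φ'' : ℝ → ℂ} (h1 : ∀ s, HasDerivAt φ (φ' s) s)
    (h2 : ∀ s, HasDerivAt φ' (φ'' s) s) {M : ℝ} {t : ℝ}
    (hM : ∀ s, |s| ≤ |t| → ‖φ'' s‖ ≤ M) :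
    ‖φ 0 - (φ t + φ (-t)) / 2‖ ≤ M * t ^ 2 := by
  have hc : Convex ℝ (Set.Icc (-|t|) |t|) := convex_Icc _ _
  have hM0 : 0 ≤ M := (norm_nonneg _).trans (hM 0 (by simp))
  have A : ∀ a ∈ Set.Icc (-|t|) |t|, ‖φ' a - φ' (-a)‖ ≤ M * (2 * |t|) := by
    intro a ha
    have hna : -a ∈ Set.Icc (-|t|) |t| := ⟨by linarith [ha.2], by linarith [ha.1]⟩
    have := hc.norm_image_sub_le_of_norm_hasDerivWithin_le (f := φ') (f' := φ'')
      (fun x _ => (h2 x).hasDerivWithinAt) (fun x hx => hM x (abs_le.2 hx)) hna ha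
    refine this.trans ?_
    gcongr
    rw [Real.norm_eq_abs, abs_le]
    constructor <;> linarith [ha.1, ha.2]
  have B := hc.norm_image_sub_le_of_norm_hasDerivWithin_le (f := fun a => φ a + φ (-a))
    (f' := fun a => φ' a - φ' (-a))
    (fun x _ => by
      have := (h1 x).add ((h1 (-x)).scomp x (hasDerivAt_neg x))
      simpa [sub_eq_add_neg, Function.comp_def] using! this.hasDerivWithinAt) A
      (x := 0) (y := t) (by simp) ⟨neg_abs_le t, le_abs_self t⟩
  have e : φ 0 - (φ t + φ (-t)) / 2 = -(1/2 : ℂ) * (φ t + φ (-t) - (φ 0 + φ (-0))) := by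
    simp; ring
  rw [e, norm_mul]
  have : ‖(-(1/2:ℂ))‖ = 1/2 := by norm_num
  rw [this]
  calc _ ≤ 1 / 2 * (M * (2 * |t|) * ‖t - 0‖) := by gcongr
    _ = _ := by rw [sub_zero, Real.norm_eq_abs, ← sq_abs]; ring

lemma line_deriv (g : 𝓢(ℝ × ℝ, ℂ)) (x v : ℝ × ℝ) (s : ℝ) :
    HasDerivAt (fun s : ℝ => g (x + s • v)) ((LineDeriv.lineDerivOp v g) (x + s • v)) s := by
  rw [lineDerivOp_apply_eq_fderiv]
  have h := (g.differentiableAt (x := x + s • v)).hasFDerivAt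
  have h' : HasDerivAt (fun s : ℝ => x + s • v) v s := by
    simpa using ((hasDerivAt_id s).smul_const v).const_add x
  exact h.comp_hasDerivAt s h'

noncomputable def uu (g : ℝ × ℝ → ℂ) (v x : ℝ × ℝ) (t : ℝ) : ℂ :=
  (g x - (g (x + t • v) + g (x + (-t) • v)) / 2) / (t : ℂ) ^ 2

lemma uu_small (g : 𝓢(ℝ × ℝ, ℂ)) (v : ℝ × ℝ) :
    ∃ C, 0 ≤ C ∧ ∀ x t, |t| ≤ 1 → ‖uu g v x t‖ ≤ C * ((1 + ‖x‖) ^ 4)⁻¹ := by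
  obtain ⟨C, hC, h⟩ := decay4 (LineDeriv.lineDerivOp v (LineDeriv.lineDerivOp v g))
  refine ⟨C * (1 + ‖v‖) ^ 4, by positivity, fun x t ht => ?_⟩
  unfold uu
  by_cases h0 : t = 0
  · subst h0; simp; positivity
  have := second_diff (φ := fun s => g (x + s • v)) (t := t)
    (M := C * (1 + ‖v‖) ^ 4 * ((1 + ‖x‖) ^ 4)⁻¹)
    (line_deriv g x v) (line_deriv (LineDeriv.lineDerivOp v g) x v) (fun s hs => by
      refine (h _).trans ?_
      rw [mul_assoc]
      gcongr
      have : 1 + ‖x‖ ≤ (1 + ‖v‖) * (1 + ‖x + s • v‖) := by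
        have h1 : ‖x‖ ≤ ‖x + s • v‖ + ‖s • v‖ := by
          calc ‖x‖ = ‖(x + s • v) - s • v‖ := by simp
            _ ≤ _ := norm_sub_le _ _
        have h2 : ‖s • v‖ ≤ ‖v‖ := by
          rw [norm_smul, Real.norm_eq_abs]
          exact mul_le_of_le_one_left (norm_nonneg _) (hs.trans ht)
        nlinarith [norm_nonneg v, norm_nonneg (x + s • v)]
      rw [← div_eq_mul_inv, le_div_iff₀ (by positivity), inv_mul_le_iff₀ (by positivity), ← mul_pow,
        mul_comm (1 + ‖x + s • v‖)]
      gcongr)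
  rw [norm_div, norm_pow, Complex.norm_real, Real.norm_eq_abs, sq_abs, div_le_iff₀ (by positivity)]
  simpa using this

lemma uu_meas (g : 𝓢(ℝ × ℝ, ℂ)) (v : ℝ × ℝ) :
    Measurable (fun p : (ℝ × ℝ) × ℝ => uu g v p.1 p.2) := by
  unfold uu
  have := g.continuous.measurable
  have hs : Measurable (fun p : (ℝ × ℝ) × ℝ => p.2 • v) :=
    Continuous.measurable (by fun_prop)
  have hs' : Measurable (fun p : (ℝ × ℝ) × ℝ => (-p.2) • v) :=
    Continuous.measurable (by fun_prop)
  fun_prop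

lemma uu_int (g : 𝓢(ℝ × ℝ, ℂ)) (v : ℝ × ℝ) :
    Integrable (fun p : (ℝ × ℝ) × ℝ => uu g v p.1 p.2) (volume.prod volume) := by
  obtain ⟨C, hC, h⟩ := uu_small g v
  have ht : ∀ w, Integrable (fun x => g (x + w)) := fun w => g.integrable.comp_add_right w
  have hti : ∀ w, ∫ x, ‖g (x + w)‖ = ∫ x, ‖g x‖ := fun w =>
    integral_add_right_eq_self (fun x => ‖g x‖) w
  have hx : ∀ t, Integrable (fun x => uu g v x t) := by
    intro t
    unfold uu
    exact ((g.integrable.sub (((ht _).add (ht _)).div_const 2)).div_const _)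
  rw [integrable_prod_iff' (uu_meas g v).aestronglyMeasurable]
  refine ⟨Eventually.of_forall hx, ?_⟩
  set D := ∫ x : ℝ × ℝ, ((1 + ‖x‖) ^ 4)⁻¹ with hD
  have hD0 : 0 ≤ D := integral_nonneg fun x => by positivity
  set N := ∫ x, ‖g x‖ with hN
  have hN0 : 0 ≤ N := integral_nonneg fun x => by positivity
  refine (integrable_inv_one_add_sq.const_mul (2 * (C * D + 2 * N))).mono' ?_
    (Eventually.of_forall fun t => ?_)
  · exact ((uu_meas g v).norm.stronglyMeasurable.integral_prod_left').aestronglyMeasurable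
  simp only
  rw [Real.norm_of_nonneg (integral_nonneg fun x => norm_nonneg _)]
  rw [← div_eq_mul_inv, le_div_iff₀ (by positivity)]
  by_cases ht1 : |t| ≤ 1
  · have : ∫ x, ‖uu g v x t‖ ≤ C * D := by
      rw [hD, ← integral_const_mul]
      exact integral_mono (hx t).norm (int4.const_mul C) fun x => h x t ht1
    have h2 : t ^ 2 ≤ 1 := (sq_le_one_iff_abs_le_one t).2 ht1
    have h3 : 0 ≤ ∫ x, ‖uu g v x t‖ := integral_nonneg fun x => norm_nonneg _
    nlinarith
  · push Not at ht1
    have h2 : 1 < t ^ 2 := (one_lt_sq_iff_one_lt_abs t).2 ht1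
    have : ∫ x, ‖uu g v x t‖ ≤ 2 * N / t ^ 2 := by
      calc _ ≤ ∫ x, (‖g x‖ + (‖g (x + t • v)‖ + ‖g (x + (-t) • v)‖) / 2) / t ^ 2 := by
            refine integral_mono (hx t).norm
              ((g.integrable.norm.add (((ht _).norm.add (ht _).norm).div_const 2)).div_const _)
              fun x => ?_
            simp only [uu, norm_div, norm_pow, Complex.norm_real, Real.norm_eq_abs, sq_abs]
            gcongr
            refine (norm_sub_le _ _).trans ?_
            rw [norm_div]
            simp only [Complex.norm_ofNat]
            gcongr
            exact norm_add_le _ _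
        _ = _ := by
            have hi : Integrable (fun x => (‖g (x + t • v)‖ + ‖g (x + (-t) • v)‖) / 2) :=
              ((ht _).norm.add (ht _).norm).div_const 2
            rw [integral_div, integral_add g.integrable.norm hi, integral_div,
              integral_add (ht _).norm (ht _).norm, hti, hti]
            ring
    rw [le_div_iff₀ (by positivity)] at this
    have h3 : 0 ≤ ∫ x, ‖uu g v x t‖ := integral_nonneg fun x => norm_nonneg _
    nlinarith [mul_nonneg hC hD0]


lemma cos_ee (r : ℝ) : ((Real.cos (2 * Real.pi * r) : ℝ) : ℂ) = (ee r + ee (-r)) / 2 := by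
  unfold ee
  push_cast
  rw [Complex.cos]
  congr 3
  ring_nf

lemma one_le_w (x : ℝ × ℝ) : 1 ≤ 1 + ‖x‖ := by linarith [norm_nonneg x]

lemma w_add (x y : ℝ × ℝ) : 1 + ‖x + y‖ ≤ (1 + ‖x‖) * (1 + ‖y‖) := by
  nlinarith [norm_add_le x y, norm_nonneg x, norm_nonneg y]

lemma abs_dt_le_w (v ξ : ℝ × ℝ) : |dt v ξ| ≤ 2 * ‖v‖ * (1 + ‖ξ‖) :=
  (abs_dt_le v ξ).trans (by nlinarith [norm_nonneg v, norm_nonneg ξ])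

lemma int_absmul (G : 𝓢(ℝ × ℝ, ℂ)) (v : ℝ × ℝ) :
    Integrable (fun ξ => ((|dt v ξ| : ℝ) : ℂ) * G ξ) := by
  refine ((integrable_poly G).const_mul (2 * ‖v‖)).mono'
    (Continuous.aestronglyMeasurable (by have := G.continuous; fun_prop))
    (Eventually.of_forall fun ξ => ?_)
  rw [norm_mul, Complex.norm_real, Real.norm_eq_abs, abs_abs, ← mul_assoc]
  gcongr
  refine (abs_dt_le_w v ξ).trans ?_
  gcongr
  nlinarith [one_le_w ξ]

lemma qqG_int (G : 𝓢(ℝ × ℝ, ℂ)) (v x : ℝ × ℝ) :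
    Integrable (fun p : (ℝ × ℝ) × ℝ => ((qq (dt v p.1) p.2 : ℝ) : ℂ) *
      (G p.1 * ee (dt x p.1))) (volume.prod volume) := by
  have hm : Measurable (fun p : (ℝ × ℝ) × ℝ => ((qq (dt v p.1) p.2 : ℝ) : ℂ) *
      (G p.1 * ee (dt x p.1))) := by
    refine Measurable.mul ?_ ?_
    · have hq : Measurable (fun p : (ℝ × ℝ) × ℝ => qq (dt v p.1) p.2) := by
        unfold qq dt
        fun_prop
      exact hq.complex_ofReal
    · exact Continuous.measurable (by have := G.continuous; fun_prop)
  rw [integrable_prod_iff hm.aestronglyMeasurable]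
  constructor
  · refine Eventually.of_forall fun ξ => ?_
    have h1 : Integrable (fun t => ((qq (dt v ξ) t : ℝ) : ℂ)) := (qq_int (dt v ξ)).ofReal
    exact h1.mul_const (G ξ * ee (dt x ξ))
  · refine ((int_absmul G v).norm.mul_const KK).congr (Eventually.of_forall fun ξ => ?_)
    simp only [norm_mul, Complex.norm_real, ee_norm, mul_one, Real.norm_eq_abs, abs_abs]
    rw [integral_mul_const]
    simp_rw [abs_of_nonneg (qq_nonneg _ _)]
    rw [qq_integral]; ring

lemma absD_eq_uu (g : 𝓢(ℝ × ℝ, ℂ)) (v x : ℝ × ℝ) :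
    absD v g x * (KK : ℂ) = ∫ t, uu g v x t := by
  obtain ⟨G, hG⟩ := exists_FF g
  have hinv : ∀ y, ∫ ξ, G ξ * ee (dt y ξ) = g y := by
    intro y
    have := congrFun (schwartz_inv g) y
    rw [← hG] at this
    exact this
  have hGe : ∀ y, Integrable (fun ξ => G ξ * ee (dt y ξ)) := by
    intro y
    refine G.integrable.norm.mono' (Continuous.aestronglyMeasurable
      (by have := G.continuous; fun_prop)) (Eventually.of_forall fun ξ => ?_)
    rw [norm_mul, ee_norm, mul_one]
  have hI := qqG_int G v x
  have e1 : absD v g x * (KK : ℂ) = ∫ ξ, ∫ t, ((qq (dt v ξ) t : ℝ) : ℂ) * (G ξ * ee (dt x ξ)) := by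
    unfold absD TT
    rw [← integral_mul_const]
    congr 1; ext ξ
    rw [integral_mul_const, integral_complex_ofReal, qq_integral, hG]
    push_cast; ring
  rw [e1, integral_integral_swap hI]
  congr 1; ext t
  unfold uu
  have hi2 : Integrable (fun ξ => (G ξ * ee (dt (x + t • v) ξ) +
      G ξ * ee (dt (x + (-t) • v) ξ)) / 2) := ((hGe _).add (hGe _)).div_const 2
  rw [← hinv x, ← hinv (x + t • v), ← hinv (x + (-t) • v), ← integral_add (hGe _) (hGe _),
    ← integral_div, ← integral_sub (hGe _) hi2, ← integral_div]
  congr 1; ext ξ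
  unfold qq
  rw [dt_add_left, dt_add_left, dt_smul_left, dt_smul_left, ee_add, ee_add]
  rw [Complex.ofReal_div, Complex.ofReal_sub, cos_ee]
  rw [neg_mul]
  push_cast
  ring

lemma absD_int (g : 𝓢(ℝ × ℝ, ℂ)) (v : ℝ × ℝ) : Integrable (absD v g) := by
  have h := (uu_int g v).integral_prod_left.div_const (KK : ℂ)
  refine h.congr (Eventually.of_forall fun x => ?_)
  simp only
  rw [← absD_eq_uu]
  have : (KK : ℂ) ≠ 0 := by exact_mod_cast KK_pos.ne'
  field_simp

lemma FF_absD (g : 𝓢(ℝ × ℝ, ℂ)) (v : ℝ × ℝ) :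
    FF (absD v g) = fun ξ => ((|dt v ξ| : ℝ) : ℂ) * FF g ξ := by
  obtain ⟨G, hG⟩ := exists_FF g
  have : absD v g = TT (fun ξ => ((|dt v ξ| : ℝ) : ℂ) * FF g ξ) := rfl
  rw [this]
  have hi := absD_int g v
  rw [this] at hi
  rw [← hG] at *
  exact FF_TT (by have := G.continuous; fun_prop) (int_absmul G v) hi

lemma FF_conv {A h : ℝ × ℝ → ℂ} (hA : Integrable A) (hh : Integrable h) (ξ : ℝ × ℝ) :
    FF (fun y => A y * TT h y) ξ = ∫ β, h β * FF A (ξ - β) := by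
  unfold FF TT
  have hI : Integrable (fun p : (ℝ × ℝ) × (ℝ × ℝ) => A p.1 * h p.2 *
      (ee (dt p.1 p.2) * ee (-dt p.1 ξ))) (volume.prod volume) := by
    refine (hA.mul_prod hh).mul_bdd (c := 1) (Continuous.aestronglyMeasurable (by fun_prop))
      (Eventually.of_forall fun p => ?_)
    simp [ee_norm]
  calc _ = ∫ y, ∫ β, A y * h β * (ee (dt y β) * ee (-dt y ξ)) := by
        congr 1; ext y
        simp only
        rw [← integral_const_mul, ← integral_mul_const]
        congr 1; ext β; ring
    _ = ∫ β, ∫ y, A y * h β * (ee (dt y β) * ee (-dt y ξ)) := integral_integral_swap hI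
    _ = _ := by
        congr 1; ext β
        rw [← integral_const_mul]
        congr 1; ext y
        rw [dt_sub_right, neg_sub, sub_eq_add_neg, ee_add]; ring

lemma shear : MeasurePreserving (fun p : (ℝ × ℝ) × (ℝ × ℝ) => (p.1 - p.2, p.2))
    (volume.prod volume) (volume.prod volume) := by
  have := measurePreserving_sub_prod (G := ℝ × ℝ) volume volume
  exact this

lemma TT_conv_int {A h m : ℝ × ℝ → ℂ} 
    (hI : Integrable (fun p : (ℝ × ℝ) × (ℝ × ℝ) => m (p.1 + p.2) * A p.1 * h p.2)
      (volume.prod volume)) :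
    Integrable (fun ξ => m ξ * ∫ β, h β * A (ξ - β)) := by
  have hI3 := (shear.integrable_comp_of_integrable hI).integral_prod_left
  refine hI3.congr (Eventually.of_forall fun ξ => ?_)
  beta_reduce
  rw [← integral_const_mul]
  congr 1; ext β
  simp; ring

lemma TT_conv {A h m : ℝ × ℝ → ℂ} {x : ℝ × ℝ}
    (hI : Integrable (fun p : (ℝ × ℝ) × (ℝ × ℝ) => m (p.1 + p.2) * A p.1 * h p.2)
      (volume.prod volume)) :
    TT (fun ξ => m ξ * ∫ β, h β * A (ξ - β)) x =
      ∫ p : (ℝ × ℝ) × (ℝ × ℝ), m (p.1 + p.2) * A p.1 * h p.2 * ee (dt x (p.1 + p.2))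
        ∂(volume.prod volume) := by
  have hI2 : Integrable (fun p : (ℝ × ℝ) × (ℝ × ℝ) => m (p.1 + p.2) * A p.1 * h p.2 *
      ee (dt x (p.1 + p.2))) (volume.prod volume) := by
    refine hI.mul_bdd (c := 1) (Continuous.aestronglyMeasurable (by fun_prop))
      (Eventually.of_forall fun p => ?_)
    simp [ee_norm]
  have hemb : MeasurableEmbedding (fun p : (ℝ × ℝ) × (ℝ × ℝ) => (p.1 - p.2, p.2)) :=
    (MeasurableEquiv.mk (α := (ℝ × ℝ) × (ℝ × ℝ)) (β := (ℝ × ℝ) × (ℝ × ℝ))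
      ⟨fun p => (p.1 - p.2, p.2), fun p => (p.1 + p.2, p.2), fun p => by simp, fun p => by simp⟩
      (by simp; fun_prop) (by simp; fun_prop)).measurableEmbedding
  have hI3 := shear.integrable_comp_of_integrable hI2
  rw [← shear.integral_comp hemb]
  refine Eq.trans ?_ (integral_prod _ hI3).symm
  unfold TT
  congr 1; ext ξ
  beta_reduce
  rw [← integral_const_mul, ← integral_mul_const]
  congr 1; ext β
  simp only [Function.comp_apply, sub_add_cancel]; ring


lemma int_w (Fa Ff : 𝓢(ℝ × ℝ, ℂ)) {w : (ℝ × ℝ) × (ℝ × ℝ) → ℝ}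
    (hw : AEStronglyMeasurable w (volume.prod volume)) (C : ℝ)
    (hb : ∀ p, |w p| ≤ C * ((1 + ‖p.1‖) ^ 2 * (1 + ‖p.2‖) ^ 2)) :
    Integrable (fun p : (ℝ × ℝ) × (ℝ × ℝ) => (w p : ℂ) * Fa p.1 * Ff p.2)
      (volume.prod volume) := by
  refine (((integrable_poly Fa).mul_prod (integrable_poly Ff)).const_mul C).mono' ?_
    (Eventually.of_forall fun p => ?_)
  · have h1 : AEStronglyMeasurable (fun p : (ℝ × ℝ) × (ℝ × ℝ) => (w p : ℂ)) (volume.prod volume) :=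
      Complex.continuous_ofReal.comp_aestronglyMeasurable hw
    refine (h1.mul (Continuous.aestronglyMeasurable ?_)).mul (Continuous.aestronglyMeasurable ?_)
    · exact Fa.continuous.comp continuous_fst
    · exact Ff.continuous.comp continuous_snd
  · rw [norm_mul, norm_mul, Complex.norm_real, Real.norm_eq_abs]
    calc _ ≤ (C * ((1 + ‖p.1‖) ^ 2 * (1 + ‖p.2‖) ^ 2)) * ‖Fa p.1‖ * ‖Ff p.2‖ := by
          gcongr; exact hb p
      _ = _ := by ring

def e1 : ℝ × ℝ := (1, 0)
def e2 : ℝ × ℝ := (0, 1)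

lemma dt_e1 (ξ) : dt e1 ξ = ξ.1 := by simp [dt, e1]
lemma dt_e2 (ξ) : dt e2 ξ = ξ.2 := by simp [dt, e2]

lemma b1 (ξ : ℝ × ℝ) : |ξ.1| ≤ 1 + ‖ξ‖ := by
  have := norm_fst_le ξ; rw [Real.norm_eq_abs] at this; linarith
lemma b2 (ξ : ℝ × ℝ) : |ξ.2| ≤ 1 + ‖ξ‖ := by
  have := norm_snd_le ξ; rw [Real.norm_eq_abs] at this; linarith

lemma wbound {a b : ℝ} {p : (ℝ × ℝ) × (ℝ × ℝ)} (ha : |a| ≤ (1 + ‖p.1‖) * (1 + ‖p.2‖))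
    (hb : |b| ≤ (1 + ‖p.1‖) * (1 + ‖p.2‖)) :
    |(|a| * |b|)| ≤ 1 * ((1 + ‖p.1‖) ^ 2 * (1 + ‖p.2‖) ^ 2) := by
  rw [abs_mul, abs_abs, abs_abs, one_mul]
  calc _ ≤ ((1 + ‖p.1‖) * (1 + ‖p.2‖)) * ((1 + ‖p.1‖) * (1 + ‖p.2‖)) := by gcongr
    _ = _ := by ring

lemma bs1 (p : (ℝ × ℝ) × (ℝ × ℝ)) : |(p.1 + p.2).1| ≤ (1 + ‖p.1‖) * (1 + ‖p.2‖) :=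
  (b1 _).trans (w_add _ _)
lemma bs2 (p : (ℝ × ℝ) × (ℝ × ℝ)) : |(p.1 + p.2).2| ≤ (1 + ‖p.1‖) * (1 + ‖p.2‖) :=
  (b2 _).trans (w_add _ _)
lemma bt1 (p : (ℝ × ℝ) × (ℝ × ℝ)) : |p.2.1| ≤ (1 + ‖p.1‖) * (1 + ‖p.2‖) :=
  (b1 _).trans (by nlinarith [one_le_w p.1, one_le_w p.2])
lemma bt2 (p : (ℝ × ℝ) × (ℝ × ℝ)) : |p.2.2| ≤ (1 + ‖p.1‖) * (1 + ‖p.2‖) :=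
  (b2 _).trans (by nlinarith [one_le_w p.1, one_le_w p.2])

lemma int_e {h : (ℝ × ℝ) × (ℝ × ℝ) → ℂ} (hI : Integrable h (volume.prod volume)) (x : ℝ × ℝ) :
    Integrable (fun p => h p * ee (dt x (p.1 + p.2))) (volume.prod volume) := by
  refine hI.mul_bdd (c := 1) (Continuous.aestronglyMeasurable (by fun_prop))
      (Eventually.of_forall fun p => ?_)
  simp [ee_norm]

lemma LHS (A f Fa Ff : 𝓢(ℝ × ℝ, ℂ)) (hFa : ⇑Fa = FF A) (hFf : ⇑Ff = FF f) (x : ℝ × ℝ) :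
    doubleComm A f x = ∫ p : (ℝ × ℝ) × (ℝ × ℝ),
      (((|p.2.1| - |p.1.1 + p.2.1|) * (|p.2.2| - |p.1.2 + p.2.2|) : ℝ) : ℂ) * Fa p.1 * Ff p.2 *
        ee (dt x (p.1 + p.2)) ∂(volume.prod volume) := by
  have hf : TT Ff = f := by rw [hFf]; exact schwartz_inv f
  have hA : TT Fa = A := by rw [hFa]; exact schwartz_inv A
  have I1 := int_w Fa Ff (w := fun p => |(p.1 + p.2).1| * |(p.1 + p.2).2|)
    (Continuous.aestronglyMeasurable (by fun_prop)) 1 fun p => wbound (bs1 p) (bs2 p)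
  have I2 := int_w Fa Ff (w := fun p => |p.2.1| * |(p.1 + p.2).2|)
    (Continuous.aestronglyMeasurable (by fun_prop)) 1 fun p => wbound (bt1 p) (bs2 p)
  have I3 := int_w Fa Ff (w := fun p => |(p.1 + p.2).1| * |p.2.2|)
    (Continuous.aestronglyMeasurable (by fun_prop)) 1 fun p => wbound (bs1 p) (bt2 p)
  have I4 := int_w Fa Ff (w := fun p => |p.2.1| * |p.2.2|)
    (Continuous.aestronglyMeasurable (by fun_prop)) 1 fun p => wbound (bt1 p) (bt2 p)
  -- the product as a Schwartz function
  obtain ⟨Q, hQ⟩ : ∃ Q : 𝓢(ℝ × ℝ, ℂ), ⇑Q = fun y => A y * f y :=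
    ⟨SchwartzMap.pairing (ContinuousLinearMap.mul ℝ ℂ) A f, by ext y; simp⟩
  have iAf : ∀ ξ, FF Q ξ = ∫ β, Ff β * Fa (ξ - β) := by
    intro ξ
    rw [hQ, ← hf, FF_conv A.integrable Ff.integrable, hFa]
  have abs1 : absD e1 f = TT (fun ξ => ((|ξ.1| : ℝ) : ℂ) * Ff ξ) := by
    ext y; unfold absD; simp only [dt_e1, hFf]
  have abs2 : absD e2 f = TT (fun ξ => ((|ξ.2| : ℝ) : ℂ) * Ff ξ) := by
    ext y; unfold absD; simp only [dt_e2, hFf]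
  have hi1 : Integrable (fun ξ : ℝ × ℝ => ((|ξ.1| : ℝ) : ℂ) * Ff ξ) := by
    simpa only [dt_e1] using int_absmul Ff e1
  have hi2 : Integrable (fun ξ : ℝ × ℝ => ((|ξ.2| : ℝ) : ℂ) * Ff ξ) := by
    simpa only [dt_e2] using int_absmul Ff e2
  -- comm1
  have iA1 : Integrable (fun y => A y * absD e1 f y) := by
    obtain ⟨C, hC, h⟩ := decay4 A
    refine (absD_int f e1).bdd_mul (c := C) A.continuous.aestronglyMeasurable
      (Eventually.of_forall fun y => (h y).trans ?_)
    exact mul_le_of_le_one_right hC (inv_le_one_of_one_le₀ (one_le_pow₀ (one_le_w y)))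
  have emul : ∀ {h : ℝ × ℝ → ℂ} (ξ), Integrable h → Integrable (fun y => h y * ee (-dt y ξ)) := by
    intro h ξ hh
    refine hh.mul_bdd (c := 1) (Continuous.aestronglyMeasurable (by fun_prop))
      (Eventually.of_forall fun p => ?_)
    simp [ee_norm]
  have emul' : ∀ {h : ℝ × ℝ → ℂ} (ξ), Integrable h → Integrable (fun y => h y * ee (dt ξ y)) := by
    intro h ξ hh
    refine hh.mul_bdd (c := 1) (Continuous.aestronglyMeasurable (by fun_prop))
      (Eventually.of_forall fun p => ?_)
    simp [ee_norm]
  have c1 : comm1 A f = fun y => absD e1 Q y - A y * absD e1 f y := by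
    unfold comm1; ext y; rw [absD1_eq, absD1_eq, hQ]; rfl
  have Fc : ∀ ξ, FF (comm1 A f) ξ = ((|ξ.1| : ℝ) : ℂ) * (∫ β, Ff β * Fa (ξ - β)) -
      ∫ β, ((|β.1| : ℝ) : ℂ) * Ff β * Fa (ξ - β) := by
    intro ξ
    have h1 : FF (comm1 A f) ξ = FF (absD e1 Q) ξ - FF (fun y => A y * absD e1 f y) ξ := by
      rw [c1]
      unfold FF
      rw [← integral_sub (emul ξ (absD_int Q e1)) (emul ξ iA1)]
      congr 1; ext y; ring
    rw [h1, FF_absD, abs1, FF_conv A.integrable hi1, ← hFa]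
    simp only [dt_e1, iAf]
  have T1 := TT_conv (x := x) (A := Fa) (h := Ff)
    (m := fun ξ => ((|ξ.1| * |ξ.2| : ℝ) : ℂ)) I1
  have T1i := TT_conv_int (A := Fa) (h := Ff)
    (m := fun ξ => ((|ξ.1| * |ξ.2| : ℝ) : ℂ)) I1
  have I2' : Integrable (fun p : (ℝ × ℝ) × (ℝ × ℝ) => ((|(p.1 + p.2).2| : ℝ) : ℂ) * Fa p.1 *
      (((|p.2.1| : ℝ) : ℂ) * Ff p.2)) (volume.prod volume) :=
    I2.congr (Eventually.of_forall fun p => by push_cast; ring)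
  have I3' : Integrable (fun p : (ℝ × ℝ) × (ℝ × ℝ) => ((|(p.1 + p.2).1| : ℝ) : ℂ) * Fa p.1 *
      (((|p.2.2| : ℝ) : ℂ) * Ff p.2)) (volume.prod volume) :=
    I3.congr (Eventually.of_forall fun p => by push_cast; ring)
  have T2 := TT_conv (x := x) (A := Fa) (h := fun β => ((|β.1| : ℝ) : ℂ) * Ff β)
    (m := fun ξ => ((|ξ.2| : ℝ) : ℂ)) I2'
  have T2i := TT_conv_int (A := Fa) (h := fun β => ((|β.1| : ℝ) : ℂ) * Ff β)
    (m := fun ξ => ((|ξ.2| : ℝ) : ℂ)) I2'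
  have T3 := TT_conv (x := x) (A := Fa) (h := fun β => ((|β.2| : ℝ) : ℂ) * Ff β)
    (m := fun ξ => ((|ξ.1| : ℝ) : ℂ)) I3'
  have S1 : absD2 (comm1 A f) x = TT (fun ξ => ((|ξ.1| * |ξ.2| : ℝ) : ℂ) * ∫ β, Ff β * Fa (ξ - β)) x
      - TT (fun ξ => ((|ξ.2| : ℝ) : ℂ) * ∫ β, ((|β.1| : ℝ) : ℂ) * Ff β * Fa (ξ - β)) x := by
    rw [absD2_eq]
    change absD e2 _ x = _
    unfold absD
    simp only [dt_e2, Fc]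
    unfold TT
    rw [← integral_sub (emul' x T1i) (emul' x T2i)]
    congr 1; ext ξ; push_cast; ring
  have S2 : absD1 (fun y => A y * absD2 f y) x =
      TT (fun ξ => ((|ξ.1| : ℝ) : ℂ) * ∫ β, ((|β.2| : ℝ) : ℂ) * Ff β * Fa (ξ - β)) x := by
    rw [absD1_eq, absD2_eq]
    change absD e1 (fun y => A y * absD e2 f y) x = _
    conv_lhs => unfold absD
    change TT (fun ξ => ((|dt e1 ξ| : ℝ) : ℂ) * FF (fun y => A y * absD e2 f y) ξ) x = _
    rw [abs2]
    simp only [dt_e1, FF_conv A.integrable hi2, ← hFa]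
  have S3 : A x * absD1 (fun y => absD2 f y) x = ∫ p : (ℝ × ℝ) × (ℝ × ℝ),
      (Fa p.1 * ee (dt x p.1)) * (((|p.2.1| : ℝ) : ℂ) * (((|p.2.2| : ℝ) : ℂ) * Ff p.2) *
        ee (dt x p.2)) ∂(volume.prod volume) := by
    rw [integral_prod_mul (fun α => Fa α * ee (dt x α))
      (fun β : ℝ × ℝ => ((|β.1| : ℝ) : ℂ) * (((|β.2| : ℝ) : ℂ) * Ff β) * ee (dt x β))]
    congr 1
    · rw [← hA]; rfl
    · rw [absD1_eq, absD2_eq]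
      change absD e1 (absD e2 f) x = _
      unfold absD
      have := FF_absD f e2
      unfold absD at this
      rw [this]
      simp only [dt_e1, dt_e2, ← hFf]
      rfl
  unfold doubleComm
  have c2 : comm1 A (fun y => absD2 f y) x = absD1 (fun y => A y * absD2 f y) x
    - A x * absD1 (fun y => absD2 f y) x := rfl
  rw [c2, S1, S2, S3, T1, T2, T3]
  have J4 : Integrable (fun p : (ℝ × ℝ) × (ℝ × ℝ) =>
      (Fa p.1 * ee (dt x p.1)) * (((|p.2.1| : ℝ) : ℂ) * (((|p.2.2| : ℝ) : ℂ) * Ff p.2) *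
        ee (dt x p.2))) (volume.prod volume) := by
    refine (int_e I4 x).congr (Eventually.of_forall fun p => ?_)
    simp only [dt_add_right, ee_add]; push_cast; ring
  rw [← integral_sub (int_e I1 x) (int_e I2' x), ← integral_sub (int_e I3' x) J4]
  refine (integral_sub ((int_e I1 x).sub (int_e I2' x)) ((int_e I3' x).sub J4)).symm.trans ?_
  congr 1; ext p
  simp only [dt_add_right, ee_add, Prod.fst_add, Prod.snd_add, Pi.sub_apply]; push_cast; ring


def II (ε : ℝ) : Set ℝ := {t | ε < |t| ∧ |t| < ε⁻¹}

lemma II_meas (ε : ℝ) : MeasurableSet (II ε) := by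
  unfold II
  have h : Measurable (fun t : ℝ => |t|) := continuous_abs.measurable
  exact (measurableSet_lt measurable_const h).inter (measurableSet_lt h measurable_const)

lemma II_fin (ε : ℝ) : volume (II ε) ≠ ∞ := by
  have : II ε ⊆ Set.Icc (-ε⁻¹) ε⁻¹ := fun t ht => abs_le.1 ht.2.le
  exact ((measure_mono this).trans_lt (by simp)).ne

lemma trunc_eq (ε : ℝ) : truncSet2 ε = II ε ×ˢ II ε := by
  ext t; simp [truncSet2, II]

noncomputable def PP (ε b : ℝ) : ℝ := ∫ t in II ε, qq b t

lemma PP_meas (ε : ℝ) : Measurable (PP ε) := by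
  unfold PP
  exact (qq_meas.stronglyMeasurable.integral_prod_right' (ν := volume.restrict (II ε))).measurable

lemma PP_abs (ε b : ℝ) : |PP ε b| ≤ |b| * KK := by
  rw [← qq_integral, abs_of_nonneg (show 0 ≤ PP ε b from integral_nonneg fun t => qq_nonneg b t)]
  exact setIntegral_le_integral (qq_int b) (Eventually.of_forall fun t => qq_nonneg b t)

lemma PP_tendsto (b : ℝ) : Tendsto (fun ε => PP ε b) (𝓝[>] 0) (𝓝 (|b| * KK)) := by
  rw [← qq_integral]
  unfold PP
  simp_rw [← integral_indicator (II_meas _)]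
  refine tendsto_integral_filter_of_dominated_convergence (fun t => qq b t) ?_ ?_ (qq_int b) ?_
  · exact Eventually.of_forall fun ε => (qq_int b).aestronglyMeasurable.indicator (II_meas ε)
  · refine Eventually.of_forall fun ε => Eventually.of_forall fun t => ?_
    refine (norm_indicator_le_norm_self _ _).trans ?_
    rw [Real.norm_of_nonneg (qq_nonneg b t)]
  · have : ∀ᵐ t : ℝ, t ≠ 0 := by simp [ae_iff]
    filter_upwards [this] with t ht
    have ht' : 0 < |t| := abs_pos.2 ht
    refine tendsto_const_nhds.congr' ?_
    have h1 : ∀ᶠ ε : ℝ in 𝓝[>] 0, ε < |t| := nhdsWithin_le_nhds (eventually_lt_nhds ht')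
    have h2 : ∀ᶠ ε : ℝ in 𝓝[>] 0, ε < |t|⁻¹ :=
      nhdsWithin_le_nhds (eventually_lt_nhds (by positivity))
    filter_upwards [h1, h2, self_mem_nhdsWithin] with ε h1 h2 h3
    have h3' : (0:ℝ) < ε := h3
    rw [Set.indicator_of_mem]
    exact ⟨h1, (lt_inv_comm₀ h3' ht').1 h2⟩

lemma inv_sq_int {ε : ℝ} (hε : 0 < ε) (c : ℝ) :
    Integrable (fun t : ℝ => c / t ^ 2) (volume.restrict (II ε)) := by
  refine Measure.integrableOn_of_bounded (M := |c| / ε ^ 2) (II_fin ε)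
    (Measurable.aestronglyMeasurable (by fun_prop)) ?_
  refine (ae_restrict_iff' (II_meas ε)).2 (Eventually.of_forall fun t ht => ?_)
  rw [norm_div, norm_pow, Real.norm_eq_abs, Real.norm_eq_abs]
  have := ht.1
  gcongr

noncomputable def kk (t a b : ℝ) : ℂ := ee (t * b) * (ee (t * a) - 1) / (t : ℂ) ^ 2

lemma kk_norm (t a b : ℝ) : ‖kk t a b‖ ≤ 2 / t ^ 2 := by
  unfold kk
  rw [norm_div, norm_mul, ee_norm, one_mul, norm_pow, Complex.norm_real, Real.norm_eq_abs, sq_abs]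
  gcongr
  refine (norm_sub_le _ _).trans ?_
  rw [ee_norm]; norm_num

lemma one_sub_int {ε : ℝ} (hε : 0 < ε) (b : ℝ) :
    Integrable (fun t : ℝ => (1 - ee (t * b)) / (t : ℂ) ^ 2) (volume.restrict (II ε)) := by
  refine (inv_sq_int hε 2).mono' (Measurable.aestronglyMeasurable ?_)
    (Eventually.of_forall fun t => ?_)
  · have : Measurable (fun t : ℝ => ee (t * b)) := Continuous.measurable (by fun_prop)
    fun_prop
  · rw [norm_div, norm_pow, Complex.norm_real, Real.norm_eq_abs, sq_abs]
    gcongr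
    refine (norm_sub_le _ _).trans ?_
    rw [ee_norm]; norm_num

lemma one_sub_eq {ε : ℝ} (hε : 0 < ε) (b : ℝ) :
    ∫ t in II ε, (1 - ee (t * b)) / (t : ℂ) ^ 2 = (PP ε b : ℂ) := by
  have hI := one_sub_int hε b
  have hI' := one_sub_int hε (-b)
  have hs : ∫ t in II ε, (1 - ee (t * b)) / (t : ℂ) ^ 2 =
      ∫ t in II ε, (1 - ee (t * (-b))) / (t : ℂ) ^ 2 := by
    rw [← integral_indicator (II_meas _), ← integral_indicator (II_meas _), ← integral_neg_eq_self]
    congr 1; ext t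
    by_cases ht : t ∈ II ε
    · have ht' : -t ∈ II ε := by simpa [II] using ht
      rw [Set.indicator_of_mem ht, Set.indicator_of_mem ht']
      simp
    · have ht' : -t ∉ II ε := by simpa [II] using ht
      rw [Set.indicator_of_notMem ht, Set.indicator_of_notMem ht']
  have h2 : ∫ t in II ε, (1 - ee (t * b)) / (t : ℂ) ^ 2 =
      ((∫ t in II ε, (1 - ee (t * b)) / (t : ℂ) ^ 2) +
      ∫ t in II ε, (1 - ee (t * (-b))) / (t : ℂ) ^ 2) / 2 := by
    rw [← hs]; ring
  rw [h2, ← integral_add hI hI', ← integral_div, PP, ← integral_complex_ofReal]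
  congr 1; ext t
  unfold qq
  rw [Complex.ofReal_div, Complex.ofReal_sub, cos_ee, mul_neg]
  push_cast; ring

lemma kk_int_eq {ε : ℝ} (hε : 0 < ε) (a b : ℝ) :
    ∫ t in II ε, kk t a b = ((PP ε b - PP ε (a + b) : ℝ) : ℂ) := by
  rw [Complex.ofReal_sub, ← one_sub_eq hε, ← one_sub_eq hε,
    ← integral_sub (one_sub_int hε _) (one_sub_int hε _)]
  congr 1; ext t
  unfold kk
  rw [mul_add, ee_add]; ring

lemma trunc_pt (A f Fa Ff : 𝓢(ℝ × ℝ, ℂ)) (hFa : ⇑Fa = FF A) (hFf : ⇑Ff = FF f) (x t : ℝ × ℝ) :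
    f (x.1 + t.1, x.2 + t.2) * diffQuot2 A x t / ((t.1 : ℂ) * (t.2 : ℂ)) =
      ∫ p : (ℝ × ℝ) × (ℝ × ℝ), (kk t.1 p.1.1 p.2.1 * kk t.2 p.1.2 p.2.2) *
        (Fa p.1 * Ff p.2 * ee (dt x (p.1 + p.2))) ∂(volume.prod volume) := by
  have hf : ∀ y, f y = ∫ ξ, Ff ξ * ee (dt y ξ) := fun y => by
    have := congrFun (schwartz_inv f) y
    rw [← hFf] at this; exact this.symm
  have hA : ∀ y, A y = ∫ ξ, Fa ξ * ee (dt y ξ) := fun y => by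
    have := congrFun (schwartz_inv A) y
    rw [← hFa] at this; exact this.symm
  have hi : ∀ y, Integrable (fun ξ => Fa ξ * ee (dt y ξ)) := by
    intro y
    refine Fa.integrable.mul_bdd (c := 1) (Continuous.aestronglyMeasurable (by fun_prop))
      (Eventually.of_forall fun p => ?_)
    simp [ee_norm]
  have hnum : A (x.1 + t.1, x.2 + t.2) - A (x.1 + t.1, x.2) - A (x.1, x.2 + t.2) + A (x.1, x.2) =
      ∫ ξ, Fa ξ * ee (dt x ξ) * (ee (t.1 * ξ.1) - 1) * (ee (t.2 * ξ.2) - 1) := by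
    rw [hA (x.1 + t.1, x.2 + t.2), hA (x.1 + t.1, x.2), hA (x.1, x.2 + t.2), hA (x.1, x.2),
      ← integral_sub (hi _) (hi _)]
    refine (congrArg (· + _) (integral_sub ((hi _).sub (hi _)) (hi _)).symm).trans ?_
    refine (integral_add (((hi _).sub (hi _)).sub (hi _)) (hi _)).symm.trans ?_
    congr 1; ext ξ
    simp only [dt, add_mul, ee_add, Pi.sub_apply]
    ring
  unfold diffQuot2
  rw [hnum, hf]
  have := integral_prod_mul (μ := (volume : Measure (ℝ × ℝ))) (ν := (volume : Measure (ℝ × ℝ)))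
    (fun ξ => Fa ξ * ee (dt x ξ) * (ee (t.1 * ξ.1) - 1) * (ee (t.2 * ξ.2) - 1))
    (fun ξ => Ff ξ * ee (dt (x.1 + t.1, x.2 + t.2) ξ))
  rw [← mul_div_assoc, mul_comm, ← this, div_div, ← integral_div]
  congr 1; ext p
  unfold kk
  simp only [dt, add_mul, mul_add, ee_add, Prod.fst_add, Prod.snd_add]
  ring

lemma trunc_int (A f Fa Ff : 𝓢(ℝ × ℝ, ℂ)) (hFa : ⇑Fa = FF A) (hFf : ⇑Ff = FF f) (x : ℝ × ℝ)
    {ε : ℝ} (hε : 0 < ε) :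
    ∫ t in truncSet2 ε, f (x.1 + t.1, x.2 + t.2) * diffQuot2 A x t / ((t.1 : ℂ) * (t.2 : ℂ)) =
      ∫ p : (ℝ × ℝ) × (ℝ × ℝ), (((PP ε p.2.1 - PP ε (p.1.1 + p.2.1)) *
        (PP ε p.2.2 - PP ε (p.1.2 + p.2.2)) : ℝ) : ℂ) * Fa p.1 * Ff p.2 *
        ee (dt x (p.1 + p.2)) ∂(volume.prod volume) := by
  simp_rw [trunc_pt A f Fa Ff hFa hFf x]
  rw [trunc_eq, Measure.volume_eq_prod ℝ ℝ, ← Measure.prod_restrict]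
  rw [← Measure.volume_eq_prod ℝ ℝ]
  set ν := (volume : Measure ℝ).restrict (II ε) with hν
  have hΦ : Integrable (fun p : (ℝ × ℝ) × (ℝ × ℝ) => Fa p.1 * Ff p.2 * ee (dt x (p.1 + p.2)))
      (volume.prod volume) := int_e (Fa.integrable.mul_prod Ff.integrable) x
  have hI : Integrable (fun q : (ℝ × ℝ) × ((ℝ × ℝ) × (ℝ × ℝ)) =>
      (kk q.1.1 q.2.1.1 q.2.2.1 * kk q.1.2 q.2.1.2 q.2.2.2) *
        (Fa q.2.1 * Ff q.2.2 * ee (dt x (q.2.1 + q.2.2))))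
      ((ν.prod ν).prod (volume.prod volume)) := by
    refine (((inv_sq_int hε 2).mul_prod (inv_sq_int hε 2)).mul_prod hΦ.norm).mono' ?_
      (Eventually.of_forall fun q => ?_)
    · refine Measurable.aestronglyMeasurable ?_
      refine Measurable.mul ?_ ?_
      · unfold kk
        have he : Measurable ee := ee_cont.measurable
        fun_prop
      · have := Fa.continuous
        have := Ff.continuous
        exact Continuous.measurable (by fun_prop)
    · rw [norm_mul, norm_mul (kk _ _ _)]
      gcongr
      · exact kk_norm _ _ _
      · exact kk_norm _ _ _
  rw [integral_integral_swap hI]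
  congr 1; ext p
  rw [integral_mul_const, integral_prod_mul (fun t => kk t p.1.1 p.2.1) (fun t => kk t p.1.2 p.2.2),
    kk_int_eq hε, kk_int_eq hε]
  push_cast; ring

lemma main_tendsto (A f : 𝓢(ℝ × ℝ, ℂ)) (x : ℝ × ℝ) :
    Tendsto (fun ε : ℝ => ∫ t in truncSet2 ε,
      f (x.1 + t.1, x.2 + t.2) * diffQuot2 (⇑A) x t / ((t.1 : ℂ) * (t.2 : ℂ)))
      (𝓝[>] 0) (𝓝 ((KK : ℂ) ^ 2 * doubleComm A f x)) := by
  obtain ⟨Fa, hFa⟩ := exists_FF A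
  obtain ⟨Ff, hFf⟩ := exists_FF f
  rw [LHS A f Fa Ff hFa hFf, ← integral_const_mul]
  have hK := KK_pos.le
  have key : Tendsto (fun ε : ℝ => ∫ p : (ℝ × ℝ) × (ℝ × ℝ),
      (((PP ε p.2.1 - PP ε (p.1.1 + p.2.1)) *
        (PP ε p.2.2 - PP ε (p.1.2 + p.2.2)) : ℝ) : ℂ) * Fa p.1 * Ff p.2 *
        ee (dt x (p.1 + p.2)) ∂(volume.prod volume)) (𝓝[>] 0)
      (𝓝 (∫ p : (ℝ × ℝ) × (ℝ × ℝ), (KK : ℂ) ^ 2 *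
        ((((|p.2.1| - |p.1.1 + p.2.1|) * (|p.2.2| - |p.1.2 + p.2.2|) : ℝ) : ℂ) * Fa p.1 * Ff p.2 *
        ee (dt x (p.1 + p.2))) ∂(volume.prod volume))) := by
    have hW : ∀ ε (p : (ℝ × ℝ) × (ℝ × ℝ)), |(PP ε p.2.1 - PP ε (p.1.1 + p.2.1)) *
        (PP ε p.2.2 - PP ε (p.1.2 + p.2.2))| ≤
          (4 * KK ^ 2) * ((1 + ‖p.1‖) ^ 2 * (1 + ‖p.2‖) ^ 2) := by
      intro ε p
      rw [abs_mul]
      have h1 : |PP ε p.2.1 - PP ε (p.1.1 + p.2.1)| ≤ 2 * KK * ((1 + ‖p.1‖) * (1 + ‖p.2‖)) := by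
        have := (abs_sub _ _).trans (add_le_add (PP_abs ε p.2.1) (PP_abs ε (p.1.1 + p.2.1)))
        have ha := mul_le_mul_of_nonneg_right (bt1 p) hK
        have hb := mul_le_mul_of_nonneg_right (bs1 p) hK
        simp only [Prod.fst_add] at hb
        linarith
      have h2 : |PP ε p.2.2 - PP ε (p.1.2 + p.2.2)| ≤ 2 * KK * ((1 + ‖p.1‖) * (1 + ‖p.2‖)) := by
        have := (abs_sub _ _).trans (add_le_add (PP_abs ε p.2.2) (PP_abs ε (p.1.2 + p.2.2)))
        have ha := mul_le_mul_of_nonneg_right (bt2 p) hK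
        have hb := mul_le_mul_of_nonneg_right (bs2 p) hK
        simp only [Prod.snd_add] at hb
        linarith
      calc _ ≤ (2 * KK * ((1 + ‖p.1‖) * (1 + ‖p.2‖))) * (2 * KK * ((1 + ‖p.1‖) * (1 + ‖p.2‖))) := by
            gcongr
        _ = _ := by ring
    have hWm : ∀ ε, Measurable (fun p : (ℝ × ℝ) × (ℝ × ℝ) => (PP ε p.2.1 - PP ε (p.1.1 + p.2.1)) *
        (PP ε p.2.2 - PP ε (p.1.2 + p.2.2))) := by
      intro ε
      have := PP_meas ε
      fun_prop
    refine tendsto_integral_filter_of_dominated_convergence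
      (fun p => (4 * KK ^ 2) * (((1 + ‖p.1‖) ^ 2 * ‖Fa p.1‖) * ((1 + ‖p.2‖) ^ 2 * ‖Ff p.2‖))) ?_ ?_
      (((integrable_poly Fa).mul_prod (integrable_poly Ff)).const_mul _) ?_
    · refine Eventually.of_forall fun ε => ?_
      exact (int_e (int_w Fa Ff (hWm ε).aestronglyMeasurable _ (hW ε)) x).aestronglyMeasurable
    · refine Eventually.of_forall fun ε => Eventually.of_forall fun p => ?_
      rw [norm_mul, norm_mul, norm_mul, ee_norm, mul_one, Complex.norm_real, Real.norm_eq_abs]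
      calc _ ≤ ((4 * KK ^ 2) * ((1 + ‖p.1‖) ^ 2 * (1 + ‖p.2‖) ^ 2)) * ‖Fa p.1‖ * ‖Ff p.2‖ := by
            gcongr; exact hW ε p
        _ = _ := by ring
    · refine Eventually.of_forall fun p => ?_
      have h := ((PP_tendsto p.2.1).sub (PP_tendsto (p.1.1 + p.2.1))).mul
        ((PP_tendsto p.2.2).sub (PP_tendsto (p.1.2 + p.2.2)))
      have h' := (((Complex.continuous_ofReal.tendsto _).comp h).mul_const (Fa p.1)).mul_const (Ff p.2)
      have h'' := h'.mul_const (ee (dt x (p.1 + p.2)))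
      refine (Eq.subst (motive := fun z => Tendsto _ _ (𝓝 z)) ?_ h'')
      push_cast; ring
  refine key.congr' ?_
  filter_upwards [self_mem_nhdsWithin] with ε hε
  exact (trunc_int A f Fa Ff hFa hFf x hε).symm

/-- There is a nonzero absolute constant `c` such that for all Schwartz
functions `A, f` on `ℝ²`, almost everywhere
`[|D₂|, [|D₁|, A]] f(x) = c · p.v. ∫ f(x+t) (Δ_{t₁}^{(1)}/t₁ ∘ Δ_{t₂}^{(2)}/t₂ A(x))
dt₁/t₁ dt₂/t₂`. -/
theorem stmt19 :
    ∃ c : ℂ, c ≠ 0 ∧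
      ∀ A f : 𝓢(ℝ × ℝ, ℂ),
        ∀ᵐ x ∂(volume : Measure (ℝ × ℝ)),
          ∃ L : ℂ,
            Tendsto (fun ε : ℝ =>
                ∫ t in truncSet2 ε,
                  f (x.1 + t.1, x.2 + t.2) * diffQuot2 (⇑A) x t / ((t.1 : ℂ) * (t.2 : ℂ)))
              (𝓝[>] 0) (𝓝 L) ∧
            doubleComm (⇑A) (⇑f) x = c * L := by
  have hK : (KK : ℂ) ≠ 0 := by exact_mod_cast KK_pos.ne'
  refine ⟨((KK : ℂ) ^ 2)⁻¹, by positivity, fun A f => Eventually.of_forall fun x => ?_⟩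
  refine ⟨_, main_tendsto A f x, ?_⟩
  field_simp
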